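/- Let G and H be games over a poset A. If both G and H are premotive and have parity, then G ≤ H in the intrinsic order if and only if G ≤_c H in the contextual order. -/

import Mathlib

/-- Games over a poset `α`: atomic games `[a]` for `a : α`, and composite games
`⟨L|R⟩` given by nonempty families of left and right options. -/
inductive Game (α : Type) : Type 1 where
  | atom : α → Game α
  | comp : (ι κ : Type) → (ι → Game α) → (κ → Game α) → Nonempty ι → Nonempty κ → Game α

namespace Game

variable {α β : Type}

/-- `G'` is a left option of the game. -/
def IsLeftOption (G' : Game α) : Game α → Prop
  | atom _ => False
  | comp _ _ L _ _ _ => ∃ i, L i = G'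

/-- `G'` is a right option of the game. -/
def IsRightOption (G' : Game α) : Game α → Prop
  | atom _ => False
  | comp _ _ _ R _ _ => ∃ k, R k = G'

/-- `G'` is an option of `G`. -/
def IsOption (G' G : Game α) : Prop := IsLeftOption G' G ∨ IsRightOption G' G

/-- A game is composite if it is not atomic. -/
def IsComposite : Game α → Prop
  | atom _ => False
  | comp _ _ _ _ _ _ => True

/-- `G'` is a follower of `G`: `G` itself, an option of `G`, or recursively a follower
of an option of `G`. -/
def IsFollower (G' G : Game α) : Prop := Relation.ReflTransGen IsOption G' G

/-- The dual game: Left and Right switch sides; it is a game over the opposite poset. -/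
def dual : Game α → Game αᵒᵈ
  | atom a => atom (OrderDual.toDual a)
  | comp ι κ L R hι hκ => comp κ ι (fun k => (R k).dual) (fun i => (L i).dual) hκ hι

/-- The image of a game under a (monotone) function applied to atoms. -/
def map (f : α → β) : Game α → Game β
  | atom a => atom (f a)
  | comp ι κ L R hι hκ => comp ι κ (fun i => (L i).map f) (fun k => (R k).map f) hι hκ

/-- The (disjunctive) sum of a game over `α` and a game over `β`, a game over `α × β`. -/
noncomputable def add : Game α → Game β → Game (α × β) := by
  intro G
  induction G with
  | atom g =>
    intro H
    induction H with
    | atom h => exact atom (g, h)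
    | comp ι κ L R hι hκ IHL IHR => exact comp ι κ IHL IHR hι hκ
  | comp ι κ L R hι hκ IHL IHR =>
    intro H
    induction H with
    | atom h => exact comp ι κ (fun i => IHL i (atom h)) (fun k => IHR k (atom h)) hι hκ
    | comp ι' κ' L' R' hι' hκ' IHL' IHR' =>
      exact comp (ι ⊕ ι') (κ ⊕ κ')
        (Sum.elim (fun i => IHL i (comp ι' κ' L' R' hι' hκ')) IHL')
        (Sum.elim (fun k => IHR k (comp ι' κ' L' R' hι' hκ')) IHR')
        (hι.elim fun i => ⟨Sum.inl i⟩) (hκ.elim fun k => ⟨Sum.inl k⟩)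

mutual
/-- Left has a first player winning strategy in a game over the boolean poset:
either the game is the atom `⊤`, or some left option has a second player
winning strategy for Left. -/
inductive LeftWinsFirst : Game Bool → Prop where
  | atom_top : LeftWinsFirst (atom true)
  | move {G G' : Game Bool} : IsLeftOption G' G → LeftWinsSecond G' → LeftWinsFirst G

/-- Left has a second player winning strategy in a game over the boolean poset:
every right option has a first player winning strategy for Left, and if the game
is atomic it is the atom `⊤`. -/
inductive LeftWinsSecond : Game Bool → Prop where
  | mk {G : Game Bool} : (∀ G', IsRightOption G' G → LeftWinsFirst G') →
      (∀ b, G = atom b → b = true) → LeftWinsSecond G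
end

mutual
/-- A game is even if all of its options are odd (atomic games are even). -/
inductive Even {α : Type} : Game α → Prop where
  | mk {G : Game α} : (∀ G', IsOption G' G → Odd G') → Even G

/-- A game is odd if it is composite and all of its options are even. -/
inductive Odd {α : Type} : Game α → Prop where
  | mk {G : Game α} : G.IsComposite → (∀ G', IsOption G' G → Even G') → Odd G
end

/-- A game has parity if it is even or odd. -/
def HasParity (G : Game α) : Prop := Even G ∨ Odd G

/-- `G` and `H` have matching parity (both even or both odd). -/
def MatchingParity (G H : Game α) : Prop := (Even G ∧ Even H) ∨ (Odd G ∧ Odd H)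

/-- `G` and `H` have mismatching parity (one even, the other odd). -/
def MismatchParity (G H : Game α) : Prop := (Even G ∧ Odd H) ∨ (Odd G ∧ Even H)

mutual
/-- The intrinsic order `G ≤ H` on games over a poset: every left option `G^L` of `G`
satisfies `G^L ◁ H`, every right option `H^R` of `H` satisfies `G ◁ H^R`, and if
both games are atoms `[g]`, `[h]` then `g ≤ h`. -/
inductive Le {α : Type} [PartialOrder α] : Game α → Game α → Prop where
  | mk {G H : Game α} :
      (∀ G', IsLeftOption G' G → Tri G' H) →
      (∀ H', IsRightOption H' H → Tri G H') →
      (∀ g h, G = atom g → H = atom h → g ≤ h) →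
      Le G H

/-- The intrinsic relation `G ◁ H` on games over a poset: some right option `G^R` of `G`
satisfies `G^R ≤ H`, or some left option `H^L` of `H` satisfies `G ≤ H^L`. -/
inductive Tri {α : Type} [PartialOrder α] : Game α → Game α → Prop where
  | inr {G H G' : Game α} : IsRightOption G' G → Le G' H → Tri G H
  | inl {G H H' : Game α} : IsLeftOption H' H → Le G H' → Tri G H
end

/-- The comparison game `λ(Gᵒᵖ + H)`, a game over the boolean poset, where
`λ : αᵒᵈ × α → 𝔹` is the monotone map with `λ(xᵒᵖ, y) = ⊤` iff `x ≤ y`. -/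
noncomputable def comparison [PartialOrder α] (G H : Game α) : Game Bool :=
  map (fun p : αᵒᵈ × α => @decide (OrderDual.ofDual p.1 ≤ p.2) (Classical.propDecidable _))
    (G.dual.add H)

/-- A game is locally premotive if Left has a first player winning strategy in
the comparison game `λ(Gᵒᵖ + G)`. -/
def LocallyPremotive [PartialOrder α] (G : Game α) : Prop := LeftWinsFirst (comparison G G)

/-- A game is premotive if it and all of its followers are locally premotive. -/
def Premotive [PartialOrder α] (G : Game α) : Prop :=
  ∀ G', IsFollower G' G → LocallyPremotive G'

/-- The game `* = ⟨0|0⟩` over the one-element poset. -/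
def star : Game Unit := comp Unit Unit (fun _ => atom ()) (fun _ => atom ()) ⟨()⟩ ⟨()⟩

/-- `G + *`, identified with a game over `α` via the isomorphism `α × 1 ≅ α`. -/
noncomputable def addStar (G : Game α) : Game α := map Prod.fst (G.add star)

/-- A game is locally `*`-antimonotone if `G^L + * ≤ G ≤ G^R + *` for all left and
right options `G^L`, `G^R`. -/
def LocallyStarAnti [PartialOrder α] (G : Game α) : Prop :=
  (∀ G', IsLeftOption G' G → Le G'.addStar G) ∧ (∀ G', IsRightOption G' G → Le G G'.addStar)

/-- A game is `*`-antimonotone if it and all of its followers are locally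
`*`-antimonotone. -/
def StarAnti [PartialOrder α] (G : Game α) : Prop :=
  ∀ G', IsFollower G' G → LocallyStarAnti G'

/-- `ε(G + X)`: the game `G` over `α` embedded in a context `X`, a game over the poset
`[α, 𝔹]` of monotone functions `α → 𝔹`, via the application map `ε(a, f) = f a`. -/
noncomputable def ctxSum [PartialOrder α] (G : Game α) (X : Game (α →o Bool)) : Game Bool :=
  map (fun p : α × (α →o Bool) => p.2 p.1) (G.add X)

/-- The outcome `(o_L(G), o_R(G)) ∈ 𝔹 × 𝔹` of a game over the boolean poset:
`o_L(G) = ⊤` iff Left has a first player winning strategy and `o_R(G) = ⊤` iff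
Left has a second player winning strategy. -/
noncomputable def outcome (G : Game Bool) : Bool × Bool :=
  (@decide (LeftWinsFirst G) (Classical.propDecidable _),
   @decide (LeftWinsSecond G) (Classical.propDecidable _))

/-- The contextual order `G ≤_c H`: `o(G+X) ≤ o(H+X)` for every context `X`. -/
def ContextualLe [PartialOrder α] (G H : Game α) : Prop :=
  ∀ X : Game (α →o Bool), outcome (ctxSum G X) ≤ outcome (ctxSum H X)

/-- The contextual relation `G ◁_c H`: `o_R(G+X) ≤ o_L(H+X)` for every context `X`. -/
def ContextualTri [PartialOrder α] (G H : Game α) : Prop :=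
  ∀ X : Game (α →o Bool), (outcome (ctxSum G X)).2 ≤ (outcome (ctxSum H X)).1

/-- Two games are identical when they are equal as set-based games: both are the same
atom, or both are composite with identical sets of left options and identical sets of
right options (recursively). -/
def Identical : Game α → Game α → Prop
  | atom a, atom b => a = b
  | comp _ _ L R _ _, comp _ _ L' R' _ _ =>
      ((∀ i, ∃ i', Identical (L i) (L' i')) ∧ (∀ i', ∃ i, Identical (L i) (L' i'))) ∧
      ((∀ k, ∃ k', Identical (R k) (R' k')) ∧ (∀ k', ∃ k, Identical (R k) (R' k')))
  | _, _ => False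

/-! ### Auxiliary material for the proof -/

theorem wf_option : WellFounded (IsOption (α := α)) := by
  constructor
  intro G
  induction G with
  | atom a =>
    constructor
    rintro G' (h | h) <;> exact h.elim
  | comp ι κ L R hι hκ IHL IHR =>
    constructor
    rintro G' (⟨i, rfl⟩ | ⟨k, rfl⟩)
    · exact IHL i
    · exact IHR k

theorem add_atom_atom (a : α) (b : β) : (atom a).add (atom b) = atom (a, b) := rfl

theorem isLeftOption_add (K : Game (α × β)) (G : Game α) (X : Game β) :
    IsLeftOption K (G.add X) ↔
      (∃ G', IsLeftOption G' G ∧ K = G'.add X) ∨ (∃ X', IsLeftOption X' X ∧ K = G.add X') := by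
  cases G with
  | atom g =>
    cases X with
    | atom x =>
      constructor
      · intro h; exact h.elim
      · rintro (⟨_, h, _⟩ | ⟨_, h, _⟩) <;> exact h.elim
    | comp ι κ L R hι hκ =>
      constructor
      · rintro ⟨i, rfl⟩
        exact Or.inr ⟨L i, ⟨i, rfl⟩, rfl⟩
      · rintro (⟨_, h, _⟩ | ⟨_, ⟨i, rfl⟩, rfl⟩)
        · exact h.elim
        · exact ⟨i, rfl⟩
  | comp ι κ L R hι hκ =>
    cases X with
    | atom x =>
      constructor
      · rintro ⟨i, rfl⟩
        exact Or.inl ⟨L i, ⟨i, rfl⟩, rfl⟩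
      · rintro (⟨_, ⟨i, rfl⟩, rfl⟩ | ⟨_, h, _⟩)
        · exact ⟨i, rfl⟩
        · exact h.elim
    | comp ι' κ' L' R' hι' hκ' =>
      constructor
      · rintro ⟨i | i, rfl⟩
        · exact Or.inl ⟨L i, ⟨i, rfl⟩, rfl⟩
        · exact Or.inr ⟨L' i, ⟨i, rfl⟩, rfl⟩
      · rintro (⟨_, ⟨i, rfl⟩, rfl⟩ | ⟨_, ⟨i, rfl⟩, rfl⟩)
        · exact ⟨Sum.inl i, rfl⟩
        · exact ⟨Sum.inr i, rfl⟩

theorem isRightOption_add (K : Game (α × β)) (G : Game α) (X : Game β) :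
    IsRightOption K (G.add X) ↔
      (∃ G', IsRightOption G' G ∧ K = G'.add X) ∨ (∃ X', IsRightOption X' X ∧ K = G.add X') := by
  cases G with
  | atom g =>
    cases X with
    | atom x =>
      constructor
      · intro h; exact h.elim
      · rintro (⟨_, h, _⟩ | ⟨_, h, _⟩) <;> exact h.elim
    | comp ι κ L R hι hκ =>
      constructor
      · rintro ⟨i, rfl⟩
        exact Or.inr ⟨R i, ⟨i, rfl⟩, rfl⟩
      · rintro (⟨_, h, _⟩ | ⟨_, ⟨i, rfl⟩, rfl⟩)
        · exact h.elim
        · exact ⟨i, rfl⟩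
  | comp ι κ L R hι hκ =>
    cases X with
    | atom x =>
      constructor
      · rintro ⟨i, rfl⟩
        exact Or.inl ⟨R i, ⟨i, rfl⟩, rfl⟩
      · rintro (⟨_, ⟨i, rfl⟩, rfl⟩ | ⟨_, h, _⟩)
        · exact ⟨i, rfl⟩
        · exact h.elim
    | comp ι' κ' L' R' hι' hκ' =>
      constructor
      · rintro ⟨i | i, rfl⟩
        · exact Or.inl ⟨R i, ⟨i, rfl⟩, rfl⟩
        · exact Or.inr ⟨R' i, ⟨i, rfl⟩, rfl⟩
      · rintro (⟨_, ⟨i, rfl⟩, rfl⟩ | ⟨_, ⟨i, rfl⟩, rfl⟩)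
        · exact ⟨Sum.inl i, rfl⟩
        · exact ⟨Sum.inr i, rfl⟩

theorem add_eq_atom (G : Game α) (X : Game β) (p : α × β) (h : G.add X = atom p) :
    ∃ g x, G = atom g ∧ X = atom x ∧ p = (g, x) := by
  cases G with
  | atom g =>
    cases X with
    | atom x => rw [add_atom_atom] at h; cases h; exact ⟨g, x, rfl, rfl, rfl⟩
    | comp ι κ L R hι hκ => exact nomatch (show comp _ _ _ _ _ _ = atom p from h)
  | comp ι κ L R hι hκ =>
    cases X with
    | atom x => exact nomatch (show comp _ _ _ _ _ _ = atom p from h)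
    | comp ι κ L R hι hκ => exact nomatch (show comp _ _ _ _ _ _ = atom p from h)

theorem isLeftOption_map (f : α → β) (K : Game β) (G : Game α) :
    IsLeftOption K (G.map f) ↔ ∃ G', IsLeftOption G' G ∧ K = G'.map f := by
  cases G with
  | atom g => simp [map, IsLeftOption]
  | comp ι κ L R hι hκ => simp [map, IsLeftOption, eq_comm]

theorem isRightOption_map (f : α → β) (K : Game β) (G : Game α) :
    IsRightOption K (G.map f) ↔ ∃ G', IsRightOption G' G ∧ K = G'.map f := by
  cases G with
  | atom g => simp [map, IsRightOption]
  | comp ι κ L R hι hκ => simp [map, IsRightOption, eq_comm]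

theorem map_eq_atom (f : α → β) (G : Game α) (b : β) (h : G.map f = atom b) :
    ∃ a, G = atom a ∧ b = f a := by
  cases G with
  | atom g => simp only [map, atom.injEq] at h; exact ⟨g, rfl, h.symm⟩
  | comp ι κ L R hι hκ => simp [map] at h

theorem isLeftOption_dual (K : Game αᵒᵈ) (G : Game α) :
    IsLeftOption K G.dual ↔ ∃ G', IsRightOption G' G ∧ K = G'.dual := by
  cases G with
  | atom g => simp [dual, IsLeftOption, IsRightOption]
  | comp ι κ L R hι hκ => simp [dual, IsLeftOption, IsRightOption, eq_comm]

theorem isRightOption_dual (K : Game αᵒᵈ) (G : Game α) :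
    IsRightOption K G.dual ↔ ∃ G', IsLeftOption G' G ∧ K = G'.dual := by
  cases G with
  | atom g => simp [dual, IsLeftOption, IsRightOption]
  | comp ι κ L R hι hκ => simp [dual, IsLeftOption, IsRightOption, eq_comm]

theorem dual_eq_atom (G : Game α) (b : αᵒᵈ) (h : G.dual = atom b) :
    ∃ a, G = atom a ∧ b = OrderDual.toDual a := by
  cases G with
  | atom g => simp only [dual, atom.injEq] at h; exact ⟨g, rfl, h.symm⟩
  | comp ι κ L R hι hκ => simp [dual] at h

theorem lwf_sum (p : α × β → Bool) (G : Game α) (X : Game β) :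
    LeftWinsFirst (map p (G.add X)) ↔
      (∃ g x, G = atom g ∧ X = atom x ∧ p (g, x) = true) ∨
      (∃ G', IsLeftOption G' G ∧ LeftWinsSecond (map p (G'.add X))) ∨
      (∃ X', IsLeftOption X' X ∧ LeftWinsSecond (map p (G.add X'))) := by
  constructor
  · intro h
    generalize hK : map p (G.add X) = K at h
    cases h with
    | atom_top =>
      obtain ⟨a, ha, hb⟩ := map_eq_atom _ _ _ hK
      obtain ⟨g, x, hg, hx, rfl⟩ := add_eq_atom _ _ _ ha
      exact Or.inl ⟨g, x, hg, hx, hb.symm⟩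
    | move hl hw =>
      subst hK
      obtain ⟨K', hK', rfl⟩ := (isLeftOption_map _ _ _).1 hl
      rcases (isLeftOption_add _ _ _).1 hK' with ⟨G', h', rfl⟩ | ⟨G', h', rfl⟩
      · exact Or.inr (Or.inl ⟨G', h', hw⟩)
      · exact Or.inr (Or.inr ⟨G', h', hw⟩)
  · rintro (⟨g, x, rfl, rfl, h⟩ | ⟨G', h', hw⟩ | ⟨G', h', hw⟩)
    · rw [add_atom_atom, map, h]; exact .atom_top
    · exact .move ((isLeftOption_map _ _ _).2
        ⟨_, (isLeftOption_add _ _ _).2 (Or.inl ⟨G', h', rfl⟩), rfl⟩) hw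
    · exact .move ((isLeftOption_map _ _ _).2
        ⟨_, (isLeftOption_add _ _ _).2 (Or.inr ⟨G', h', rfl⟩), rfl⟩) hw

theorem lws_sum (p : α × β → Bool) (G : Game α) (X : Game β) :
    LeftWinsSecond (map p (G.add X)) ↔
      (∀ g x, G = atom g → X = atom x → p (g, x) = true) ∧
      (∀ G', IsRightOption G' G → LeftWinsFirst (map p (G'.add X))) ∧
      (∀ X', IsRightOption X' X → LeftWinsFirst (map p (G.add X'))) := by
  constructor
  · rintro ⟨h1, h2⟩
    refine ⟨?_, ?_, ?_⟩
    · rintro g x rfl rfl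
      exact h2 _ (by rw [add_atom_atom, map])
    · intro G' h'
      exact h1 _ ((isRightOption_map _ _ _).2
        ⟨_, (isRightOption_add _ _ _).2 (Or.inl ⟨G', h', rfl⟩), rfl⟩)
    · intro G' h'
      exact h1 _ ((isRightOption_map _ _ _).2
        ⟨_, (isRightOption_add _ _ _).2 (Or.inr ⟨G', h', rfl⟩), rfl⟩)
  · rintro ⟨h1, h2, h3⟩
    refine ⟨?_, ?_⟩
    · intro K hK
      obtain ⟨K', hK', rfl⟩ := (isRightOption_map _ _ _).1 hK
      rcases (isRightOption_add _ _ _).1 hK' with ⟨G', h', rfl⟩ | ⟨G', h', rfl⟩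
      · exact h2 _ h'
      · exact h3 _ h'
    · intro b hb
      obtain ⟨a, ha, rfl⟩ := map_eq_atom _ _ _ hb
      obtain ⟨g, x, hg, hx, rfl⟩ := add_eq_atom _ _ _ ha
      exact h1 g x hg hx

section
variable [PartialOrder α]

theorem lwf_ctx (G : Game α) (X : Game (α →o Bool)) :
    LeftWinsFirst (ctxSum G X) ↔
      (∃ g x, G = atom g ∧ X = atom x ∧ x g = true) ∨
      (∃ G', IsLeftOption G' G ∧ LeftWinsSecond (ctxSum G' X)) ∨
      (∃ X', IsLeftOption X' X ∧ LeftWinsSecond (ctxSum G X')) :=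
  lwf_sum _ G X

theorem lws_ctx (G : Game α) (X : Game (α →o Bool)) :
    LeftWinsSecond (ctxSum G X) ↔
      (∀ g x, G = atom g → X = atom x → x g = true) ∧
      (∀ G', IsRightOption G' G → LeftWinsFirst (ctxSum G' X)) ∧
      (∀ X', IsRightOption X' X → LeftWinsFirst (ctxSum G X')) :=
  lws_sum _ G X

theorem lwf_comparison (G H : Game α) (hw : LeftWinsFirst (comparison G H)) :
      (∃ g h, G = atom g ∧ H = atom h ∧ g ≤ h) ∨
      (∃ G', IsRightOption G' G ∧ LeftWinsSecond (comparison G' H)) ∨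
      (∃ H', IsLeftOption H' H ∧ LeftWinsSecond (comparison G H')) := by
  rcases (lwf_sum _ _ _).1 hw with ⟨g, x, hg, hx, h⟩ | ⟨G', h', hw⟩ | ⟨G', h', hw⟩
  · obtain ⟨a, ha, hga⟩ := dual_eq_atom _ _ hg
    rw [hga] at h
    exact Or.inl ⟨a, x, ha, hx, @of_decide_eq_true _ (Classical.propDecidable _) h⟩
  · obtain ⟨K, hK, rfl⟩ := (isLeftOption_dual _ _).1 h'
    exact Or.inr (Or.inl ⟨K, hK, hw⟩)
  · exact Or.inr (Or.inr ⟨G', h', hw⟩)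

theorem lws_comparison (G H : Game α) (hw : LeftWinsSecond (comparison G H)) :
      (∀ G', IsLeftOption G' G → LeftWinsFirst (comparison G' H)) ∧
      (∀ H', IsRightOption H' H → LeftWinsFirst (comparison G H')) := by
  obtain ⟨_, h2, h3⟩ := (lws_sum _ _ _).1 hw
  exact ⟨fun G' h => h2 _ ((isRightOption_dual _ _).2 ⟨G', h, rfl⟩), h3⟩

theorem not_even_odd (G : Game α) : Even G → Odd G → False := by
  induction G using wf_option.induction with
  | _ G ih =>
    rintro ⟨h1⟩ ⟨hc, h2⟩
    cases G with
    | atom a => exact hc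
    | comp ι κ L R hι hκ =>
      obtain ⟨i⟩ := hι
      have ho : IsOption (L i) (comp ι κ L R ⟨i⟩ hκ) := Or.inl ⟨i, rfl⟩
      exact ih _ ho (h2 _ ho) (h1 _ ho)

theorem Odd.not_atom {g : α} (h : Odd (atom g)) : False := by
  cases h with | mk hc _ => exact hc

theorem Odd.exists_left {G : Game α} (h : Odd G) : ∃ G', IsLeftOption G' G ∧ Even G' := by
  cases h with
  | mk hc h =>
    cases G with
    | atom a => exact hc.elim
    | comp ι κ L R hι hκ =>
      obtain ⟨i⟩ := hι
      exact ⟨L i, ⟨i, rfl⟩, h _ (Or.inl ⟨i, rfl⟩)⟩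

theorem Odd.exists_right {G : Game α} (h : Odd G) : ∃ G', IsRightOption G' G ∧ Even G' := by
  cases h with
  | mk hc h =>
    cases G with
    | atom a => exact hc.elim
    | comp ι κ L R hι hκ =>
      obtain ⟨i⟩ := hκ
      exact ⟨R i, ⟨i, rfl⟩, h _ (Or.inr ⟨i, rfl⟩)⟩

theorem Even.opt {G G' : Game α} (h : Even G) (ho : IsOption G' G) : Odd G' := by
  cases h with | mk h => exact h _ ho

theorem Odd.opt {G G' : Game α} (h : Odd G) (ho : IsOption G' G) : Even G' := by
  cases h with | mk _ h => exact h _ ho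

/-- Premotive games with parity. -/
def Good (G : Game α) : Prop := Premotive G ∧ HasParity G

theorem Good.opt {G G' : Game α} (h : Good G) (ho : IsOption G' G) : Good G' := by
  refine ⟨fun K hK => h.1 K (Relation.ReflTransGen.tail hK ho), ?_⟩
  rcases h.2 with h | h
  · exact Or.inr (h.opt ho)
  · exact Or.inl (h.opt ho)

theorem even_of_le_atom (G : Game α) (h : α) : Le G (atom h) → ¬ Odd G := by
  induction G using wf_option.transGen.induction with
  | _ G ih =>
    rintro ⟨h1, -, -⟩ ho
    obtain ⟨G', hl, he⟩ := ho.exists_left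
    cases h1 _ hl with
    | inr hr hle =>
      exact ih _ (.tail (.single (Or.inr hr)) (Or.inl hl)) hle (he.opt (Or.inr hr))
    | inl hl _ => exact hl

theorem even_of_atom_le (G : Game α) (h : α) : Le (atom h) G → ¬ Odd G := by
  induction G using wf_option.transGen.induction with
  | _ G ih =>
    rintro ⟨-, h1, -⟩ ho
    obtain ⟨G', hl, he⟩ := ho.exists_right
    cases h1 _ hl with
    | inr hr hle => exact hr
    | inl hr hle =>
      exact ih _ (.tail (.single (Or.inl hr)) (Or.inr hl)) hle (he.opt (Or.inl hr))

theorem le_atom_aux (f : α →o Bool) (h : α) (G₁ : Game α) : ∀ G₂ : Game α,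
    Even G₁ → LeftWinsSecond (ctxSum G₁ (atom f)) → Le G₂ (atom h) →
    LeftWinsFirst (comparison G₁ G₂) → f h = true := by
  induction G₁ using wf_option.transGen.induction with
  | _ G₁ ih₁ =>
    intro G₂
    induction G₂ using wf_option.transGen.induction with
    | _ G₂ ih₂ =>
      intro he hw hle hc
      rcases lwf_comparison _ _ hc with ⟨x, y, rfl, rfl, hxy⟩ | ⟨G', hr, hs⟩ | ⟨G', hl, hs⟩
      · have hx := ((lws_ctx _ _).1 hw).1 x f rfl rfl
        obtain ⟨-, -, hyh⟩ := hle
        have := f.monotone (hxy.trans (hyh y h rfl rfl))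
        rw [hx] at this
        exact Bool.le_iff_imp.1 this rfl
      · have ho := he.opt (Or.inr hr)
        rcases (lwf_ctx _ _).1 (((lws_ctx _ _).1 hw).2.1 _ hr) with
          ⟨x, _, rfl, -, -⟩ | ⟨G'', hl', hw'⟩ | ⟨_, hf, _⟩
        · exact ho.not_atom.elim
        · exact ih₁ _ (.tail (.single (Or.inl hl')) (Or.inr hr)) _ (ho.opt (Or.inl hl')) hw' hle
            ((lws_comparison _ _ hs).1 _ hl')
        · exact hf.elim
      · have hle' := hle
        obtain ⟨h1, -, -⟩ := hle
        cases h1 _ hl with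
        | inr hr hle'' =>
          exact ih₂ _ (.tail (.single (Or.inr hr)) (Or.inl hl)) he hw hle''
            ((lws_comparison _ _ hs).2 _ hr)
        | inl hf _ => exact hf.elim

theorem atom_le_aux (f : α →o Bool) (g : α) (hg : f g = true) (H₁ : Game α) : ∀ H₂ : Game α,
    Even H₂ → Le (atom g) H₁ →
    LeftWinsFirst (comparison H₁ H₂) → LeftWinsFirst (ctxSum H₂ (atom f)) := by
  induction H₁ using wf_option.transGen.induction with
  | _ H₁ ih₁ =>
    intro H₂
    induction H₂ using wf_option.transGen.induction with
    | _ H₂ ih₂ =>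
      intro he hle hc
      rcases lwf_comparison _ _ hc with ⟨x, y, rfl, rfl, hxy⟩ | ⟨G', hr, hs⟩ | ⟨G', hl, hs⟩
      · obtain ⟨-, -, hyh⟩ := hle
        have := f.monotone ((hyh g x rfl rfl).trans hxy)
        rw [hg] at this
        exact (lwf_ctx _ _).2 (Or.inl ⟨y, f, rfl, rfl, Bool.le_iff_imp.1 this rfl⟩)
      · obtain ⟨-, h1, -⟩ := hle
        cases h1 _ hr with
        | inr hf _ => exact hf.elim
        | inl hl' hle'' =>
          exact ih₁ _ (.tail (.single (Or.inl hl')) (Or.inr hr)) _ he hle''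
            ((lws_comparison _ _ hs).1 _ hl')
      · have ho := he.opt (Or.inl hl)
        refine (lwf_ctx _ _).2 (Or.inr (Or.inl ⟨G', hl, (lws_ctx _ _).2 ⟨?_, ?_, ?_⟩⟩))
        · rintro x _ rfl -
          exact ho.not_atom.elim
        · intro G'' hr
          exact ih₂ _ (.tail (.single (Or.inr hr)) (Or.inl hl)) (ho.opt (Or.inr hr)) hle
            ((lws_comparison _ _ hs).2 _ hr)
        · intro _ hf
          exact hf.elim

theorem forward_aux (G : Game α) : ∀ (H : Game α) (X : Game (α →o Bool)), Good G → Good H →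
    (Le G H → LeftWinsSecond (ctxSum G X) → LeftWinsSecond (ctxSum H X)) ∧
    (Le G H → LeftWinsFirst (ctxSum G X) → LeftWinsFirst (ctxSum H X)) ∧
    (Tri G H → LeftWinsSecond (ctxSum G X) → LeftWinsFirst (ctxSum H X)) := by
  induction G using wf_option.induction with
  | _ G ihG =>
    intro H
    induction H using wf_option.induction with
    | _ H ihH =>
      intro X
      induction X using wf_option.induction with
      | _ X ihX =>
        intro gG gH
        refine ⟨?_, ?_, ?_⟩
        · intro hle hw
          refine (lws_ctx _ _).2 ⟨?_, ?_, ?_⟩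
          · rintro h f rfl rfl
            have he : Even G := gG.2.resolve_right (even_of_le_atom G h hle)
            exact le_atom_aux f h G G he hw hle (gG.1 G .refl)
          · intro H' hr
            obtain ⟨-, h2, -⟩ := hle
            exact (ihH _ (Or.inr hr) X gG (gH.opt (Or.inr hr))).2.2 (h2 _ hr) hw
          · intro X' hr
            exact (ihX _ (Or.inr hr) gG gH).2.1 hle (((lws_ctx _ _).1 hw).2.2 _ hr)
        · intro hle hw
          rcases (lwf_ctx _ _).1 hw with ⟨g, f, rfl, rfl, hg⟩ | ⟨G', hl, hw'⟩ | ⟨X', hl, hw'⟩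
          · have he : Even H := gH.2.resolve_right (even_of_atom_le H g hle)
            exact atom_le_aux f g hg H H he hle (gH.1 H .refl)
          · obtain ⟨h1, -, -⟩ := hle
            exact (ihG _ (Or.inl hl) H X (gG.opt (Or.inl hl)) gH).2.2 (h1 _ hl) hw'
          · exact (lwf_ctx _ _).2 (Or.inr (Or.inr ⟨X', hl,
              (ihX _ (Or.inl hl) gG gH).1 hle hw'⟩))
        · intro ht hw
          cases ht with
          | inr hr hle =>
            exact (ihG _ (Or.inr hr) H X (gG.opt (Or.inr hr)) gH).2.1 hle
              (((lws_ctx _ _).1 hw).2.1 _ hr)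
          | inl hl hle =>
            exact (lwf_ctx _ _).2 (Or.inr (Or.inl ⟨_, hl,
              (ihH _ (Or.inl hl) X gG (gH.opt (Or.inl hl))).1 hle hw⟩))

/-- The monotone map `y ↦ (x ≤ y)`. -/
noncomputable def upFun (x : α) : α →o Bool where
  toFun y := @decide (x ≤ y) (Classical.propDecidable _)
  monotone' := by
    intro y z hyz
    by_cases h : x ≤ y
    · simp [h, h.trans hyz]
    · simp [h]

theorem upFun_apply (x y : α) : upFun x y = true ↔ x ≤ y := by
  show @decide (x ≤ y) (Classical.propDecidable _) = true ↔ x ≤ y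
  simp

/-- The context obtained from the dual of `G`. -/
noncomputable def ctxOf : Game α → Game (α →o Bool)
  | atom a => atom (upFun a)
  | comp ι κ L R hι hκ => comp κ ι (fun k => ctxOf (R k)) (fun i => ctxOf (L i)) hκ hι

theorem isLeftOption_ctxOf (K : Game (α →o Bool)) (G : Game α) :
    IsLeftOption K (ctxOf G) ↔ ∃ G', IsRightOption G' G ∧ K = ctxOf G' := by
  cases G with
  | atom g => simp [ctxOf, IsLeftOption, IsRightOption]
  | comp ι κ L R hι hκ => simp [ctxOf, IsLeftOption, IsRightOption, eq_comm]

theorem isRightOption_ctxOf (K : Game (α →o Bool)) (G : Game α) :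
    IsRightOption K (ctxOf G) ↔ ∃ G', IsLeftOption G' G ∧ K = ctxOf G' := by
  cases G with
  | atom g => simp [ctxOf, IsLeftOption, IsRightOption]
  | comp ι κ L R hι hκ => simp [ctxOf, IsLeftOption, IsRightOption, eq_comm]

theorem copycat (G : Game α) : LeftWinsSecond (ctxSum G (ctxOf G)) := by
  induction G using wf_option.induction with
  | _ G ih =>
    refine (lws_ctx _ _).2 ⟨?_, ?_, ?_⟩
    · rintro g x rfl hx
      simp only [ctxOf, atom.injEq] at hx
      subst hx
      exact (upFun_apply g g).2 le_rfl
    · intro G' hr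
      exact (lwf_ctx _ _).2 (Or.inr (Or.inr
        ⟨_, (isLeftOption_ctxOf _ _).2 ⟨G', hr, rfl⟩, ih _ (Or.inr hr)⟩))
    · intro X' hr
      obtain ⟨G', hl, rfl⟩ := (isRightOption_ctxOf _ _).1 hr
      exact (lwf_ctx _ _).2 (Or.inr (Or.inl ⟨_, hl, ih _ (Or.inl hl)⟩))

theorem MatchingParity.left {G G' H : Game α} (h : MatchingParity G H) (ho : IsOption G' G) :
    MismatchParity G' H := by
  rcases h with ⟨h1, h2⟩ | ⟨h1, h2⟩
  · exact Or.inr ⟨h1.opt ho, h2⟩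
  · exact Or.inl ⟨h1.opt ho, h2⟩

theorem MatchingParity.right {G H' H : Game α} (h : MatchingParity G H) (ho : IsOption H' H) :
    MismatchParity G H' := by
  rcases h with ⟨h1, h2⟩ | ⟨h1, h2⟩
  · exact Or.inl ⟨h1, h2.opt ho⟩
  · exact Or.inr ⟨h1, h2.opt ho⟩

theorem MismatchParity.left {G G' H : Game α} (h : MismatchParity G H) (ho : IsOption G' G) :
    MatchingParity G' H := by
  rcases h with ⟨h1, h2⟩ | ⟨h1, h2⟩
  · exact Or.inr ⟨h1.opt ho, h2⟩
  · exact Or.inl ⟨h1.opt ho, h2⟩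

theorem MismatchParity.right {G H' H : Game α} (h : MismatchParity G H) (ho : IsOption H' H) :
    MatchingParity G H' := by
  rcases h with ⟨h1, h2⟩ | ⟨h1, h2⟩
  · exact Or.inl ⟨h1, h2.opt ho⟩
  · exact Or.inr ⟨h1, h2.opt ho⟩

theorem backward_aux (G : Game α) : ∀ H : Game α,
    (MatchingParity G H → LeftWinsSecond (ctxSum H (ctxOf G)) → Le G H) ∧
    (MismatchParity G H → LeftWinsFirst (ctxSum H (ctxOf G)) → Tri G H) := by
  induction G using wf_option.induction with
  | _ G ihG =>
    intro H
    induction H using wf_option.induction with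
    | _ H ihH =>
      constructor
      · intro hm hw
        obtain ⟨h1, h2, h3⟩ := (lws_ctx _ _).1 hw
        refine ⟨?_, ?_, ?_⟩
        · intro G' hl
          exact (ihG _ (Or.inl hl) H).2 (hm.left (Or.inl hl))
            (h3 _ ((isRightOption_ctxOf _ _).2 ⟨G', hl, rfl⟩))
        · intro H' hr
          exact (ihH _ (Or.inr hr)).2 (hm.right (Or.inr hr)) (h2 _ hr)
        · rintro g h rfl rfl
          exact (upFun_apply g h).1 (h1 h (upFun g) rfl rfl)
      · intro hm hw
        rcases (lwf_ctx _ _).1 hw with ⟨h, f, rfl, hf, -⟩ | ⟨H', hl, hw'⟩ | ⟨X', hl, hw2⟩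
        · exfalso
          cases G with
          | atom g =>
            rcases hm with ⟨_, h⟩ | ⟨h, _⟩
            · exact h.not_atom
            · exact h.not_atom
          | comp ι κ L R hι hκ => simp [ctxOf] at hf
        · exact .inl hl ((ihH _ (Or.inl hl)).1 (hm.right (Or.inl hl)) hw')
        · obtain ⟨G', hr, rfl⟩ := (isLeftOption_ctxOf _ _).1 hl
          have hm2 := hm.left (Or.inr hr)
          exact .inr hr ((ihG _ (Or.inr hr) H).1 hm2 hw2)

/-- The constant monotone map. -/
def constFun (b : Bool) : α →o Bool := ⟨fun _ => b, fun _ _ _ => le_refl _⟩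

/-- The zugzwang context `⟨⊥|⊤⟩`. -/
def zug : Game (α →o Bool) :=
  comp Unit Unit (fun _ => atom (constFun false)) (fun _ => atom (constFun true)) ⟨()⟩ ⟨()⟩

theorem win_top (G : Game α) : LeftWinsFirst (ctxSum G (atom (constFun true))) ∧
    LeftWinsSecond (ctxSum G (atom (constFun true))) := by
  induction G using wf_option.induction with
  | _ G ih =>
    constructor
    · cases G with
      | atom g => exact (lwf_ctx _ _).2 (Or.inl ⟨g, _, rfl, rfl, rfl⟩)
      | comp ι κ L R hι hκ =>
        obtain ⟨i⟩ := hι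
        exact (lwf_ctx _ _).2 (Or.inr (Or.inl ⟨L i, ⟨i, rfl⟩, (ih _ (Or.inl ⟨i, rfl⟩)).2⟩))
    · refine (lws_ctx _ _).2 ⟨?_, ?_, ?_⟩
      · rintro g x - hx
        cases hx
        rfl
      · intro G' hr
        exact (ih _ (Or.inr hr)).1
      · intro _ hf
        exact hf.elim

theorem lose_bot (G : Game α) : ¬ LeftWinsFirst (ctxSum G (atom (constFun false))) ∧
    ¬ LeftWinsSecond (ctxSum G (atom (constFun false))) := by
  induction G using wf_option.induction with
  | _ G ih =>
    constructor
    · intro hw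
      rcases (lwf_ctx _ _).1 hw with ⟨g, f, -, hf, h⟩ | ⟨H', hl, hw'⟩ | ⟨X', hl, hw'⟩
      · cases hf
        exact Bool.false_ne_true h
      · exact (ih _ (Or.inl hl)).2 hw'
      · exact hl
    · intro hw
      obtain ⟨h1, h2, h3⟩ := (lws_ctx _ _).1 hw
      cases G with
      | atom g => exact Bool.false_ne_true (h1 g _ rfl rfl)
      | comp ι κ L R hι hκ =>
        obtain ⟨i⟩ := hκ
        exact (ih _ (Or.inr ⟨i, rfl⟩)).1 (h2 (R i) ⟨i, rfl⟩)

theorem zug_outcome (G : Game α) :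
    (Even G → LeftWinsSecond (ctxSum G zug) ∧ ¬ LeftWinsFirst (ctxSum G zug)) ∧
    (Odd G → LeftWinsFirst (ctxSum G zug) ∧ ¬ LeftWinsSecond (ctxSum G zug)) := by
  induction G using wf_option.induction with
  | _ G ih =>
    refine ⟨fun he => ⟨?_, ?_⟩, fun ho => ⟨?_, ?_⟩⟩
    · refine (lws_ctx _ _).2 ⟨?_, ?_, ?_⟩
      · rintro g x - hx
        simp [zug] at hx
      · intro G' hr
        exact ((ih _ (Or.inr hr)).2 (he.opt (Or.inr hr))).1
      · rintro _ ⟨_, rfl⟩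
        exact (win_top G).1
    · intro hw
      rcases (lwf_ctx _ _).1 hw with ⟨g, f, -, hf, h⟩ | ⟨H', hl, hw'⟩ | ⟨X', ⟨_, rfl⟩, hw'⟩
      · simp [zug] at hf
      · exact ((ih _ (Or.inl hl)).2 (he.opt (Or.inl hl))).2 hw'
      · exact (lose_bot G).2 hw'
    · obtain ⟨G', hl, he⟩ := ho.exists_left
      exact (lwf_ctx _ _).2 (Or.inr (Or.inl ⟨G', hl, ((ih _ (Or.inl hl)).1 he).1⟩))
    · intro hw
      obtain ⟨G', hr, he⟩ := ho.exists_right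
      exact ((ih _ (Or.inr hr)).1 he).2 (((lws_ctx _ _).1 hw).2.1 _ hr)

theorem contextualLe_iff (G H : Game α) : ContextualLe G H ↔ ∀ X : Game (α →o Bool),
    (LeftWinsFirst (ctxSum G X) → LeftWinsFirst (ctxSum H X)) ∧
    (LeftWinsSecond (ctxSum G X) → LeftWinsSecond (ctxSum H X)) := by
  unfold ContextualLe outcome
  refine forall_congr' fun X => ?_
  rw [Prod.mk_le_mk]
  simp [Bool.le_iff_imp]

end

/-- For premotive games with parity, the intrinsic order coincides with
the contextual order. -/
theorem intrinsic_iff_contextual {α : Type} [PartialOrder α] (G H : Game α)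
    (hGp : Premotive G) (hHp : Premotive H) (hGpar : HasParity G) (hHpar : HasParity H) :
    Le G H ↔ ContextualLe G H := by
  rw [contextualLe_iff]
  constructor
  · intro hle X
    have := forward_aux G H X ⟨hGp, hGpar⟩ ⟨hHp, hHpar⟩
    exact ⟨this.2.1 hle, this.1 hle⟩
  · intro hc
    have hm : MatchingParity G H := by
      rcases hGpar with hG | hG <;> rcases hHpar with hH | hH
      · exact Or.inl ⟨hG, hH⟩
      · exact (((zug_outcome H).2 hH).2 ((hc zug).2 ((zug_outcome G).1 hG).1)).elim
      · exact (((zug_outcome H).1 hH).2 ((hc zug).1 ((zug_outcome G).2 hG).1)).elim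
      · exact Or.inr ⟨hG, hH⟩
    exact (backward_aux G H).1 hm ((hc (ctxOf G)).2 (copycat G))

end Game
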